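/- arXiv:1708.09104 — 2 statements merged into one kernel-verified Lean document; each statement's English description precedes it below -/
import Mathlib

section
/- For any unit vector C ∈ ℝⁿ, let A = [[−11/12, Cᵀ],[C, Idₙ − 2CCᵀ]] and ω = (1, −C) ∈ ℝ^{n+1}. Then the (n+2)×(n+2) bordered matrix [[A, ω],[ωᵀ, 0]] has determinant −1/12; in particular it is invertible. -/
/-!
STATEMENT 6: for any unit vector `C ∈ ℝⁿ`, with
`A = [[−11/12, Cᵀ],[C, Idₙ − 2CCᵀ]]` and `ω = (1, −C) ∈ ℝ^{n+1}`, the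
`(n+2)×(n+2)` bordered matrix `[[A, ω],[ωᵀ, 0]]` has determinant `−1/12`;
in particular it is invertible. The index type `(Fin 1 ⊕ Fin n) ⊕ Fin 1`
encodes the `(1 + n) + 1` block structure.
-/

noncomputable section

/-- The block matrix `A = [[−11/12, Cᵀ],[C, Idₙ − 2CCᵀ]]`. -/
def hessMat (n : ℕ) (C : Fin n → ℝ) : Matrix (Fin 1 ⊕ Fin n) (Fin 1 ⊕ Fin n) ℝ :=
  Matrix.fromBlocks
    (Matrix.of fun _ _ => (-11 / 12 : ℝ))
    (Matrix.of fun _ j => C j)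
    (Matrix.of fun i _ => C i)
    (1 - (2 : ℝ) • Matrix.vecMulVec C C)

/-- The frequency (co)vector `ω = (1, −C) ∈ ℝ^{n+1}`. -/
def omegaVec (n : ℕ) (C : Fin n → ℝ) : Fin 1 ⊕ Fin n → ℝ :=
  Sum.elim (fun _ => (1 : ℝ)) (fun i => -C i)

/-- The bordered matrix `[[A, ω],[ωᵀ, 0]]` of a square matrix `A` and a vector `ω`. -/
def bordered {m : Type*} [Fintype m] [DecidableEq m]
    (A : Matrix m m ℝ) (ω : m → ℝ) : Matrix (m ⊕ Fin 1) (m ⊕ Fin 1) ℝ :=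
  Matrix.fromBlocks A (Matrix.of fun i _ => ω i) (Matrix.of fun _ j => ω j) 0

/-- A bordered determinant whose border `ω` equals `A *ᵥ v` factors through `A.det`. -/
lemma det_bordered_mulVec {m : Type*} [Fintype m] [DecidableEq m]
    (A : Matrix m m ℝ) (v ω : m → ℝ) (h : A.mulVec v = ω) :
    (bordered A ω).det = -(A.det * (ω ⬝ᵥ v)) := by
  have key : bordered A ω *
      Matrix.fromBlocks 1 (-Matrix.replicateCol (Fin 1) v) 0 1 =
      Matrix.fromBlocks A 0 (Matrix.replicateRow (Fin 1) ω)
        (Matrix.of fun _ _ => -(ω ⬝ᵥ v)) := by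
    rw [bordered, Matrix.fromBlocks_multiply]
    subst h
    congr 1 <;> ext i j <;>
      simp [Matrix.mul_apply, Matrix.mulVec, dotProduct]
  have hdet := congrArg Matrix.det key
  rw [Matrix.det_mul, Matrix.det_fromBlocks_zero₂₁, Matrix.det_fromBlocks_zero₁₂] at hdet
  simpa using hdet

lemma det_one_sub_two_smul_vecMulVec {n : ℕ} {C : Fin n → ℝ} (hC : C ⬝ᵥ C = 1) :
    (1 - (2 : ℝ) • Matrix.vecMulVec C C).det = -1 := by
  have h : 1 - (2 : ℝ) • Matrix.vecMulVec C C =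
      1 + Matrix.replicateCol Unit ((-2 : ℝ) • C) * Matrix.replicateRow Unit C := by
    ext i j
    simp [Matrix.mul_apply, Matrix.vecMulVec_apply]
    ring
  rw [h, Matrix.det_one_add_replicateCol_mul_replicateRow, dotProduct_smul, hC]
  norm_num

lemma one_sub_two_smul_vecMulVec_mulVec {n : ℕ} {C : Fin n → ℝ} (hC : C ⬝ᵥ C = 1) :
    (1 - (2 : ℝ) • Matrix.vecMulVec C C).mulVec C = -C := by
  rw [Matrix.sub_mulVec, Matrix.one_mulVec, Matrix.smul_mulVec, Matrix.vecMulVec_mulVec, hC]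
  ext i
  simp
  ring

lemma det_hessMat {n : ℕ} {C : Fin n → ℝ} (hC : C ⬝ᵥ C = 1) :
    (hessMat n C).det = -1 / 12 := by
  have key : hessMat n C *
      Matrix.fromBlocks 1 0 (Matrix.replicateCol (Fin 1) C) 1 =
      Matrix.fromBlocks (Matrix.of fun _ _ => (1 / 12 : ℝ)) (Matrix.replicateRow (Fin 1) C) 0
        (1 - (2 : ℝ) • Matrix.vecMulVec C C) := by
    rw [hessMat, Matrix.fromBlocks_multiply]
    congr 1
    · ext i j
      have : ∑ k, C k * C k = 1 := hC
      simp [Matrix.mul_apply, this]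
      norm_num
    · simp
      rfl
    · ext i j
      rw [← Matrix.replicateCol_mulVec, one_sub_two_smul_vecMulVec_mulVec hC]
      simp
    · simp
  have hdet := congrArg Matrix.det key
  rw [Matrix.det_mul, Matrix.det_fromBlocks_zero₁₂, Matrix.det_fromBlocks_zero₂₁,
    det_one_sub_two_smul_vecMulVec hC] at hdet
  norm_num at hdet ⊢
  exact hdet

lemma hessMat_mulVec {n : ℕ} {C : Fin n → ℝ} (hC : C ⬝ᵥ C = 1) :
    (hessMat n C).mulVec (Sum.elim 0 C) = omegaVec n C := by
  rw [hessMat, Matrix.fromBlocks_mulVec, omegaVec]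
  simp only [Sum.elim_comp_inl, Sum.elim_comp_inr, Matrix.mulVec_zero, zero_add,
    one_sub_two_smul_vecMulVec_mulVec hC]
  congr 1
  ext
  exact hC

theorem bordered_hessMat_det (n : ℕ) (C : Fin n → ℝ) (hC : ∑ i, C i ^ 2 = 1) :
    (bordered (hessMat n C) (omegaVec n C)).det = -1 / 12 ∧
      IsUnit (bordered (hessMat n C) (omegaVec n C)) := by
  have hC' : C ⬝ᵥ C = 1 := by simpa [dotProduct, sq] using hC
  have hω : omegaVec n C ⬝ᵥ Sum.elim 0 C = -1 := by
    have : ∑ k, C k * C k = 1 := hC'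
    simp [omegaVec, dotProduct, this]
  have hdet : (bordered (hessMat n C) (omegaVec n C)).det = -1 / 12 := by
    rw [det_bordered_mulVec _ _ _ (hessMat_mulVec hC'), det_hessMat hC', hω]
    norm_num
  refine ⟨hdet, (Matrix.isUnit_iff_isUnit_det _).2 ?_⟩
  rw [hdet]
  norm_num

end
end

section
/- (Theorem 3, non-degeneracy of the variable-mass normal form.) For all a, b ∈ ℝ and every unit vector C ∈ ℝⁿ, let G(I,J) = G₀(I,J) + G₁(J) with α, β, γ, G₀, G₁ as in the context. Then there exists ρ₀ > 0 such that for every real ρ with 0 < |ρ| < ρ₀: (i) the (n+1)×(n+1) Hessian matrix of G in the variables (I,J), evaluated at (I,J) = (0, ρC), is invertible; and (ii) the (n+2)×(n+2) bordered matrix formed from this Hessian and the gradient ∇G(0, ρC) is invertible. -/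
/-!
STATEMENT 11 (Theorem 3, non-degeneracy of the variable-mass normal form): for all
`a, b ∈ ℝ` and every unit vector `C ∈ ℝⁿ`, with `G(I,J) = G₀(I,J) + G₁(J)` (where
`G₀(I,J) = I(1 + αI + ⟨β,J⟩ + ⟨γJ,J⟩)`, `α = (b − (3/2)a² + 5a − 22/3)/16`,
`β = (1 − a/2)C`, `γ = ((a−2)/4)Idₙ + (4α + a²/2 − 2a + 10/3)CCᵀ`), there is `ρ₀ > 0`
such that for all real `ρ` with `0 < |ρ| < ρ₀` the Hessian matrix of `G` in the
variables `(I,J)` at `(0, ρC)` is invertible, and so is the bordered matrix formed from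
this Hessian and the gradient `∇G(0, ρC)`.
The index type `Fin 1 ⊕ Fin n` encodes the `1 + n` block structure.
-/

noncomputable section

/-- `α = (b − (3/2)a² + 5a − 22/3)/16`. -/
def alphaP (a b : ℝ) : ℝ := (b - (3 / 2) * a ^ 2 + 5 * a - 22 / 3) / 16

/-- `G(I,J) = G₀(I,J) + G₁(J)`, as a function on `ℝ × ℝⁿ` (`p = (I,J)`). -/
def Gvar {n : ℕ} (a b : ℝ) (C : Fin n → ℝ) (p : ℝ × (Fin n → ℝ)) : ℝ :=
  p.1 * (1 + alphaP a b * p.1 + (1 - a / 2) * (∑ i, C i * p.2 i)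
        + (((a - 2) / 4) * (∑ i, p.2 i ^ 2)
            + (4 * alphaP a b + a ^ 2 / 2 - 2 * a + 10 / 3) * (∑ i, C i * p.2 i) ^ 2))
    - (∑ i, C i * p.2 i) - (∑ i, C i * p.2 i) ^ 2 + (∑ i, p.2 i ^ 2) / 2
    + ((∑ i, p.2 i ^ 2) - (4 / 3) * (∑ i, C i * p.2 i) ^ 2) * (∑ i, C i * p.2 i)
    - (∑ i, p.2 i ^ 2) ^ 2 / 4 + 2 * (∑ i, C i * p.2 i) ^ 2 * (∑ i, p.2 i ^ 2)
    - 2 * (∑ i, C i * p.2 i) ^ 4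

/-- The standard basis of `ℝ × ℝⁿ`, indexed by `Fin 1 ⊕ Fin n`. -/
def basisIJ (n : ℕ) : Fin 1 ⊕ Fin n → ℝ × (Fin n → ℝ) :=
  Sum.elim (fun _ => ((1 : ℝ), 0)) (fun i => ((0 : ℝ), Pi.single i 1))

/-- The Hessian matrix of `G : ℝ × ℝⁿ → ℝ` at `p`, in the variables `(I,J)`. -/
def hessianIJ {n : ℕ} (G : ℝ × (Fin n → ℝ) → ℝ) (p : ℝ × (Fin n → ℝ)) :
    Matrix (Fin 1 ⊕ Fin n) (Fin 1 ⊕ Fin n) ℝ :=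
  Matrix.of fun i j => fderiv ℝ (fderiv ℝ G) p (basisIJ n i) (basisIJ n j)

/-- The gradient vector of `G` at `p`, in the standard basis of `ℝ × ℝⁿ`. -/
def gradIJ {n : ℕ} (G : ℝ × (Fin n → ℝ) → ℝ) (p : ℝ × (Fin n → ℝ)) :
    Fin 1 ⊕ Fin n → ℝ :=
  fun i => fderiv ℝ G p (basisIJ n i)

open Filter Topology in
theorem eventually_ne_zero_of_quadratic_expansion (c₀ c₁ : ℝ) (R : ℝ → ℝ) (hR : Continuous R)
    (h : c₀ ≠ 0 ∨ c₁ ≠ 0 ∨ R 0 ≠ 0) :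
    ∀ᶠ x in 𝓝[≠] (0 : ℝ), c₀ + c₁ * x + x ^ 2 * R x ≠ 0 := by
  have key : ∀ f : ℝ → ℝ, Continuous f → f 0 ≠ 0 → ∀ᶠ x in 𝓝[≠] (0 : ℝ), f x ≠ 0 :=
    fun f hf h0 => (hf.continuousAt.eventually_ne h0).filter_mono nhdsWithin_le_nhds
  by_cases h₀ : c₀ = 0
  · by_cases h₁ : c₁ = 0
    · filter_upwards [key R hR (by tauto), self_mem_nhdsWithin] with x hx hx0
      have hx0 : x ≠ 0 := hx0
      simp [h₀, h₁, hx, hx0]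
    · filter_upwards [key (fun x => c₁ + x * R x) (by fun_prop) (by simpa using h₁),
        self_mem_nhdsWithin] with x hx hx0
      have hx0 : x ≠ 0 := hx0
      convert mul_ne_zero hx0 hx using 1
      rw [h₀]
      ring
  · exact key (fun x => c₀ + c₁ * x + x ^ 2 * R x) (by fun_prop) (by simpa using h₀)

section Derivatives

variable {n : ℕ}

theorem hasDerivAt_line_fst (p w : ℝ × (Fin n → ℝ)) :
    HasDerivAt (fun t : ℝ => (p + t • w).1) w.1 0 := by
  simpa using ((hasDerivAt_id (0 : ℝ)).mul_const w.1).const_add p.1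

theorem hasDerivAt_line_linear (C : Fin n → ℝ) (p w : ℝ × (Fin n → ℝ)) :
    HasDerivAt (fun t : ℝ => ∑ i, C i * (p + t • w).2 i) (∑ i, C i * w.2 i) 0 := by
  refine HasDerivAt.fun_sum fun i _ => ?_
  simpa using (((hasDerivAt_id (0 : ℝ)).mul_const (w.2 i)).const_add (p.2 i)).const_mul (C i)

theorem hasDerivAt_line_sq (p w : ℝ × (Fin n → ℝ)) :
    HasDerivAt (fun t : ℝ => ∑ i, (p + t • w).2 i ^ 2) (2 * ∑ i, w.2 i * p.2 i) 0 := by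
  rw [Finset.mul_sum]
  refine HasDerivAt.fun_sum fun i _ => ?_
  have h := (((hasDerivAt_id (0 : ℝ)).mul_const (w.2 i)).const_add (p.2 i)).pow 2
  refine (h.congr_deriv ?_).congr_of_eventuallyEq (.of_forall fun t => ?_)
  · simp
    ring
  · simp

theorem fderiv_apply_of_hasDerivAt_line {f : ℝ × (Fin n → ℝ) → ℝ} {p w : ℝ × (Fin n → ℝ)} {c : ℝ}
    (hf : DifferentiableAt ℝ f p) (h : HasDerivAt (fun t : ℝ => f (p + t • w)) c 0) :
    fderiv ℝ f p w = c :=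
  (hf.hasFDerivAt.hasLineDerivAt w).unique h

theorem contDiff_Gvar (a b : ℝ) (C : Fin n → ℝ) : ContDiff ℝ 2 (Gvar a b C) := by
  unfold Gvar
  fun_prop

/-- The coefficient of `CCᵀ` in `γ`. -/
def kappaP (a b : ℝ) : ℝ := 4 * alphaP a b + a ^ 2 / 2 - 2 * a + 10 / 3

theorem fderiv_Gvar (a b : ℝ) (C : Fin n → ℝ) (p w : ℝ × (Fin n → ℝ)) :
    fderiv ℝ (Gvar a b C) p w =
      w.1 * (1 + 2 * alphaP a b * p.1 + (1 - a / 2) * (∑ i, C i * p.2 i)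
        + (a - 2) / 4 * (∑ i, p.2 i ^ 2) + kappaP a b * (∑ i, C i * p.2 i) ^ 2)
      + (∑ i, C i * w.2 i) * (p.1 * (1 - a / 2 + 2 * kappaP a b * (∑ i, C i * p.2 i))
        - 1 - 2 * (∑ i, C i * p.2 i) + (∑ i, p.2 i ^ 2) - 4 * (∑ i, C i * p.2 i) ^ 2
        + 4 * (∑ i, C i * p.2 i) * (∑ i, p.2 i ^ 2) - 8 * (∑ i, C i * p.2 i) ^ 3)
      + 2 * (∑ i, w.2 i * p.2 i) * (p.1 * ((a - 2) / 4) + 1 / 2 + (∑ i, C i * p.2 i)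
        - (∑ i, p.2 i ^ 2) / 2 + 2 * (∑ i, C i * p.2 i) ^ 2) := by
  refine fderiv_apply_of_hasDerivAt_line
    ((contDiff_Gvar a b C).differentiable (by norm_num) p) ?_
  have hI := hasDerivAt_line_fst p w
  have hs := hasDerivAt_line_linear C p w
  have hq := hasDerivAt_line_sq p w
  unfold Gvar kappaP
  refine HasDerivAt.congr_deriv
    ((((((((hI.fun_mul (((((hI.const_mul (alphaP a b)).const_add 1).fun_add
      (hs.const_mul (1 - a / 2))).fun_add ((hq.const_mul ((a - 2) / 4)).fun_add
      ((hs.fun_pow 2).const_mul _))))).fun_sub hs).fun_sub (hs.fun_pow 2)).fun_add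
      (hq.div_const 2)).fun_add ((hq.fun_sub ((hs.fun_pow 2).const_mul (4 / 3))).fun_mul hs)).fun_sub
      ((hq.fun_pow 2).div_const 4)).fun_add (((hs.fun_pow 2).const_mul 2).fun_mul hq)).fun_sub
      ((hs.fun_pow 4).const_mul 2)) ?_
  simp only [zero_smul, add_zero]
  norm_num
  ring

theorem fderiv_fderiv_Gvar (a b : ℝ) (C : Fin n → ℝ) (p v w : ℝ × (Fin n → ℝ)) :
    fderiv ℝ (fderiv ℝ (Gvar a b C)) p v w =
      w.1 * (2 * alphaP a b * v.1 + (1 - a / 2) * (∑ i, C i * v.2 i)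
        + (a - 2) / 4 * (2 * ∑ i, v.2 i * p.2 i)
        + 2 * kappaP a b * (∑ i, C i * p.2 i) * (∑ i, C i * v.2 i))
      + (∑ i, C i * w.2 i) * (v.1 * (1 - a / 2 + 2 * kappaP a b * (∑ i, C i * p.2 i))
        + p.1 * (2 * kappaP a b * (∑ i, C i * v.2 i))
        - 2 * (∑ i, C i * v.2 i) + 2 * (∑ i, v.2 i * p.2 i)
        - 8 * (∑ i, C i * p.2 i) * (∑ i, C i * v.2 i)
        + 4 * (∑ i, C i * v.2 i) * (∑ i, p.2 i ^ 2)
        + 8 * (∑ i, C i * p.2 i) * (∑ i, v.2 i * p.2 i)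
        - 24 * (∑ i, C i * p.2 i) ^ 2 * (∑ i, C i * v.2 i))
      + 2 * (∑ i, w.2 i * v.2 i) * (p.1 * ((a - 2) / 4) + 1 / 2 + (∑ i, C i * p.2 i)
        - (∑ i, p.2 i ^ 2) / 2 + 2 * (∑ i, C i * p.2 i) ^ 2)
      + 2 * (∑ i, w.2 i * p.2 i) * (v.1 * ((a - 2) / 4) + (∑ i, C i * v.2 i)
        - (∑ i, v.2 i * p.2 i) + 4 * (∑ i, C i * p.2 i) * (∑ i, C i * v.2 i)) := by
  have hd : DifferentiableAt ℝ (fderiv ℝ (Gvar a b C)) p :=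
    ((contDiff_Gvar a b C).fderiv_right (m := 1) (by norm_num)).differentiable (by norm_num) p
  have happ : fderiv ℝ (fun x => fderiv ℝ (Gvar a b C) x w) p v =
      fderiv ℝ (fderiv ℝ (Gvar a b C)) p v w := by
    rw [fderiv_clm_apply hd (differentiableAt_const w)]
    simp
  rw [← happ]
  refine fderiv_apply_of_hasDerivAt_line (hd.clm_apply (differentiableAt_const w)) ?_
  have hI := hasDerivAt_line_fst p v
  have hs := hasDerivAt_line_linear C p v
  have hq := hasDerivAt_line_sq p v
  have hw := hasDerivAt_line_linear w.2 p v
  simp only [fderiv_Gvar]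
  refine HasDerivAt.congr_deriv
    ((((((((hI.const_mul (2 * alphaP a b)).const_add 1).fun_add (hs.const_mul (1 - a / 2))).fun_add
      (hq.const_mul ((a - 2) / 4))).fun_add ((hs.fun_pow 2).const_mul (kappaP a b))).const_mul
      w.1).fun_add
      ((((((((hI.fun_mul ((hs.const_mul (2 * kappaP a b)).const_add (1 - a / 2))).sub_const
      1).fun_sub (hs.const_mul 2)).fun_add hq).fun_sub ((hs.fun_pow 2).const_mul 4)).fun_add
      ((hs.const_mul 4).fun_mul hq)).fun_sub ((hs.fun_pow 3).const_mul 8)).const_mul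
      (∑ i, C i * w.2 i))).fun_add
      ((hw.const_mul 2).fun_mul (((((hI.mul_const ((a - 2) / 4)).add_const (1 / 2)).fun_add
      hs).fun_sub (hq.div_const 2)).fun_add ((hs.fun_pow 2).const_mul 2)))) ?_
  simp only [zero_smul, add_zero]
  norm_num
  ring

end Derivatives

section AlongC

variable {n : ℕ}

/-- The common factor of the mixed second derivatives `∂_I ∂_J G` at `(0, ρC)`. -/
def mixedCoeff (a b ρ : ℝ) : ℝ := 1 - a / 2 + ρ * ((a - 2) / 2 + 2 * kappaP a b)

/-- The `I`-component of `∇G(0, ρC)`. -/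
def gradCoeffI (a b ρ : ℝ) : ℝ := 1 + (1 - a / 2) * ρ + ((a - 2) / 4 + kappaP a b) * ρ ^ 2

theorem gradIJ_Gvar (a b ρ : ℝ) (C : Fin n → ℝ) (hC : ∑ i, C i ^ 2 = 1) :
    gradIJ (Gvar a b C) (0, fun i => ρ * C i) =
      Sum.elim (fun _ => gradCoeffI a b ρ) (fun i => -(1 + ρ + ρ ^ 2 + ρ ^ 3) * C i) := by
  have hs : ∑ i, C i * (ρ * C i) = ρ := by
    simp_rw [show ∀ i, C i * (ρ * C i) = ρ * C i ^ 2 from fun i => by ring, ← Finset.mul_sum, hC,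
      mul_one]
  have hq : ∑ i, (ρ * C i) ^ 2 = ρ ^ 2 := by
    simp_rw [mul_pow, ← Finset.mul_sum, hC, mul_one]
  ext (i | i)
  · simp only [gradIJ, fderiv_Gvar, hs, hq]
    simp [basisIJ, gradCoeffI]
    ring
  · simp only [gradIJ, fderiv_Gvar, hs, hq]
    simp [basisIJ, Pi.single_apply]
    ring

theorem hessianIJ_Gvar (a b ρ : ℝ) (C : Fin n → ℝ) (hC : ∑ i, C i ^ 2 = 1) :
    hessianIJ (Gvar a b C) (0, fun i => ρ * C i) =
      Matrix.fromBlocks (Matrix.of fun _ _ => 2 * alphaP a b)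
        (Matrix.of fun _ j => mixedCoeff a b ρ * C j)
        (Matrix.of fun i _ => mixedCoeff a b ρ * C i)
        ((1 + 2 * ρ + 3 * ρ ^ 2) • (1 - (2 : ℝ) • Matrix.vecMulVec C C)) := by
  have hs : ∑ i, C i * (ρ * C i) = ρ := by
    simp_rw [show ∀ i, C i * (ρ * C i) = ρ * C i ^ 2 from fun i => by ring, ← Finset.mul_sum, hC,
      mul_one]
  have hq : ∑ i, (ρ * C i) ^ 2 = ρ ^ 2 := by
    simp_rw [mul_pow, ← Finset.mul_sum, hC, mul_one]
  ext (i | i) (j | j)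
  · simp only [hessianIJ, Matrix.of_apply, fderiv_fderiv_Gvar, hs, hq]
    simp [basisIJ]
  · simp only [hessianIJ, Matrix.of_apply, fderiv_fderiv_Gvar, hs, hq]
    simp [basisIJ, Pi.single_apply, mixedCoeff]
    ring
  · simp only [hessianIJ, Matrix.of_apply, fderiv_fderiv_Gvar, hs, hq]
    simp [basisIJ, Pi.single_apply, mixedCoeff]
    ring
  · simp only [hessianIJ, Matrix.of_apply, fderiv_fderiv_Gvar, hs, hq]
    simp [basisIJ, Pi.single_apply, Matrix.one_apply, Matrix.vecMulVec_apply, eq_comm]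
    split_ifs <;> ring

end AlongC

section Invertibility

variable {n : ℕ}

theorem isUnit_of_forall_mulVec_eq_zero {m : Type*} [Fintype m] [DecidableEq m] (A : Matrix m m ℝ)
    (h : ∀ v, A.mulVec v = 0 → v = 0) : IsUnit A :=
  Matrix.mulVec_injective_iff_isUnit.1
    ((injective_iff_map_eq_zero A.mulVecLin).2 h)

theorem sum_mul_reflection (C y : Fin n → ℝ) (hC : ∑ i, C i ^ 2 = 1) (r d : ℝ)
    (h : ∀ i, r * C i + d * (y i - 2 * (∑ j, C j * y j) * C i) = 0) :
    r = d * ∑ j, C j * y j := by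
  have h1 : ∑ i, C i * (r * C i + d * (y i - 2 * (∑ j, C j * y j) * C i)) = 0 :=
    Finset.sum_eq_zero fun i _ => by rw [h i, mul_zero]
  have h2 : ∀ i, C i * (r * C i + d * (y i - 2 * (∑ j, C j * y j) * C i)) =
      (r - 2 * d * ∑ j, C j * y j) * C i ^ 2 + d * (C i * y i) := fun i => by ring
  simp_rw [h2, Finset.sum_add_distrib, ← Finset.mul_sum, hC] at h1
  linarith

theorem mulVec_reflection (C y : Fin n → ℝ) (d : ℝ) (i : Fin n) :
    ((d • (1 - (2 : ℝ) • Matrix.vecMulVec C C)).mulVec y) i =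
      d * (y i - 2 * (∑ j, C j * y j) * C i) := by
  simp [Matrix.smul_mulVec, Matrix.sub_mulVec, Matrix.vecMulVec_mulVec, dotProduct]
  ring_nf
  simp

theorem isUnit_fromBlocks_reflection (C : Fin n → ℝ) (hC : ∑ i, C i ^ 2 = 1) (A m d : ℝ)
    (hd : d ≠ 0) (hdet : A * d + m ^ 2 ≠ 0) :
    IsUnit (Matrix.fromBlocks (Matrix.of fun (_ _ : Fin 1) => A)
        (Matrix.of fun _ j => m * C j) (Matrix.of fun i _ => m * C i)
        (d • (1 - (2 : ℝ) • Matrix.vecMulVec C C))) := by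
  refine isUnit_of_forall_mulVec_eq_zero _ fun v hv => ?_
  obtain ⟨x, y, rfl⟩ : ∃ x y, v = Sum.elim x y := ⟨_, _, (Sum.elim_comp_inl_inr v).symm⟩
  rw [Matrix.fromBlocks_mulVec] at hv
  have h1 := congrFun hv (Sum.inl 0)
  have h2 : ∀ i, (m * x 0) * C i + d * (y i - 2 * (∑ j, C j * y j) * C i) = 0 := fun i => by
    have h := congrFun hv (Sum.inr i)
    simp only [Sum.elim_inr, Pi.add_apply, mulVec_reflection, Sum.elim_comp_inl,
      Sum.elim_comp_inr] at h
    simp [Matrix.mulVec, dotProduct] at h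
    linarith
  simp [Matrix.mulVec, dotProduct, mul_assoc, ← Finset.mul_sum] at h1
  have h3 := sum_mul_reflection C y hC _ _ h2
  generalize ∑ j, C j * y j = t at h1 h2 h3
  have ht : t = 0 := by
    refine (mul_eq_zero.1 (?_ : (A * d + m ^ 2) * t = 0)).resolve_left hdet
    linear_combination m * h1 - A * h3
  have hx : x 0 = 0 := by
    refine (mul_eq_zero.1 (?_ : (A * d + m ^ 2) * x 0 = 0)).resolve_left hdet
    linear_combination d * h1 + m * h3
  have hy : ∀ i, y i = 0 := fun i => by simpa [ht, hx, hd] using h2 i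
  ext (i | i)
  · simpa [Subsingleton.elim i 0] using hx
  · simpa using hy i

theorem isUnit_bordered_reflection (C : Fin n → ℝ) (hC : ∑ i, C i ^ 2 = 1) (A m d k l : ℝ)
    (hd : d ≠ 0) (hdet : 2 * m * k * l + d * k ^ 2 - A * l ^ 2 ≠ 0) :
    IsUnit (bordered (Matrix.fromBlocks (Matrix.of fun (_ _ : Fin 1) => A)
        (Matrix.of fun _ j => m * C j) (Matrix.of fun i _ => m * C i)
        (d • (1 - (2 : ℝ) • Matrix.vecMulVec C C)))
        (Sum.elim (fun _ => k) (fun i => l * C i))) := by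
  refine isUnit_of_forall_mulVec_eq_zero _ fun v hv => ?_
  obtain ⟨u, z, rfl⟩ : ∃ u z, v = Sum.elim u z := ⟨_, _, (Sum.elim_comp_inl_inr v).symm⟩
  obtain ⟨x, y, rfl⟩ : ∃ x y, u = Sum.elim x y := ⟨_, _, (Sum.elim_comp_inl_inr u).symm⟩
  rw [bordered, Matrix.fromBlocks_mulVec] at hv
  simp only [Sum.elim_comp_inl, Sum.elim_comp_inr, Matrix.fromBlocks_mulVec] at hv
  have h1 := congrFun hv (Sum.inl (Sum.inl 0))
  have h0 := congrFun hv (Sum.inr 0)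
  have h2 : ∀ i, (m * x 0 + l * z 0) * C i + d * (y i - 2 * (∑ j, C j * y j) * C i) = 0 :=
    fun i => by
    have h := congrFun hv (Sum.inl (Sum.inr i))
    simp only [Sum.elim_inl, Sum.elim_inr, Pi.add_apply, mulVec_reflection] at h
    simp [Matrix.mulVec, dotProduct] at h
    linarith
  simp [Matrix.mulVec, dotProduct, mul_assoc, ← Finset.mul_sum] at h1 h0
  have h3 := sum_mul_reflection C y hC _ _ h2
  generalize ∑ j, C j * y j = t at h0 h1 h2 h3
  have hx : x 0 = 0 := by
    refine (mul_eq_zero.1 (?_ : (2 * m * k * l + d * k ^ 2 - A * l ^ 2) * x 0 = 0)).resolve_left hdet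
    linear_combination (m * l + d * k) * h0 - l ^ 2 * h1 + k * l * h3
  have ht : t = 0 := by
    refine (mul_eq_zero.1 (?_ : (2 * m * k * l + d * k ^ 2 - A * l ^ 2) * t = 0)).resolve_left hdet
    linear_combination (m * k - A * l) * h0 + k * l * h1 - k ^ 2 * h3
  have hz : z 0 = 0 := by
    refine (mul_eq_zero.1 (?_ : (2 * m * k * l + d * k ^ 2 - A * l ^ 2) * z 0 = 0)).resolve_left hdet
    linear_combination (d * k + m * l) * h1 + (m * k - A * l) * h3 - (A * d + m ^ 2) * h0
  have hy : ∀ i, y i = 0 := fun i => by simpa [ht, hx, hz, hd] using h2 i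
  ext ((i | i) | i)
  · simpa [Subsingleton.elim i 0] using hx
  · simpa using hy i
  · simpa [Subsingleton.elim i 0] using hz

end Invertibility

section Determinants

open Filter Topology

theorem eventually_hessian_det_ne_zero (a b : ℝ) :
    ∀ᶠ ρ in 𝓝[≠] (0 : ℝ),
      2 * alphaP a b * (1 + 2 * ρ + 3 * ρ ^ 2) + mixedCoeff a b ρ ^ 2 ≠ 0 := by
  have h := eventually_ne_zero_of_quadratic_expansion
    (2 * alphaP a b + (1 - a / 2) ^ 2)
    (4 * alphaP a b + 2 * (1 - a / 2) * ((a - 2) / 2 + 2 * kappaP a b))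
    (fun _ => 6 * alphaP a b + ((a - 2) / 2 + 2 * kappaP a b) ^ 2) (by fun_prop) (by
      by_contra! hcon
      obtain ⟨h0, h1, h2⟩ := hcon
      have hα : alphaP a b = -(1 - a / 2) ^ 2 / 2 := by linarith
      simp only [kappaP, hα] at h1 h2
      obtain ⟨u, rfl⟩ : ∃ u, a = 2 - 2 * u := ⟨1 - a / 2, by ring⟩
      have h3 : u * (u - 4 / 3) = 0 := by linear_combination -h1 / 4
      rcases mul_eq_zero.1 h3 with hu | hu
      · subst hu
        norm_num at h2
      · obtain rfl : u = 4 / 3 := by linarith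
        norm_num at h2)
  filter_upwards [h] with ρ hρ
  convert hρ using 1
  unfold mixedCoeff
  ring

theorem eventually_bordered_det_ne_zero (a b : ℝ) :
    ∀ᶠ ρ in 𝓝[≠] (0 : ℝ),
      2 * mixedCoeff a b ρ * gradCoeffI a b ρ * (-(1 + ρ + ρ ^ 2 + ρ ^ 3))
        + (1 + 2 * ρ + 3 * ρ ^ 2) * gradCoeffI a b ρ ^ 2
        - 2 * alphaP a b * (-(1 + ρ + ρ ^ 2 + ρ ^ 3)) ^ 2 ≠ 0 := by
  obtain ⟨u, rfl⟩ : ∃ u, a = 2 - 2 * u := ⟨1 - a / 2, by ring⟩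
  set α := alphaP (2 - 2 * u) b with hα
  set κ := kappaP (2 - 2 * u) b with hκ
  have hκα : κ = 4 * α + 2 * u ^ 2 + 4 / 3 := by
    rw [hκ, kappaP, ← hα]
    ring
  let e : ℝ := κ - u / 2
  let m₁ : ℝ := 2 * κ - u
  have h := eventually_ne_zero_of_quadratic_expansion
    (-2 * u + 1 - 2 * α) (-2 * (m₁ + u ^ 2 + u) + 2 + 2 * u - 4 * α)
    (fun ρ =>
      -2 * (m₁ * u + u * e + m₁ * e * ρ + (m₁ + u ^ 2 + (m₁ * u + u * e) * ρ + m₁ * e * ρ ^ 2)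
        + (u + (m₁ + u ^ 2) * ρ + (m₁ * u + u * e) * ρ ^ 2 + m₁ * e * ρ ^ 3) * (1 + ρ))
      + (2 * e + u ^ 2 + 2 * u * e * ρ + e ^ 2 * ρ ^ 2
        + 2 * (2 * u + (2 * e + u ^ 2) * ρ + 2 * u * e * ρ ^ 2 + e ^ 2 * ρ ^ 3)
        + 3 * (1 + u * ρ + e * ρ ^ 2) ^ 2)
      - 2 * α * (3 + 4 * ρ + 3 * ρ ^ 2 + 2 * ρ ^ 3 + ρ ^ 4)) (by fun_prop) (by
      by_contra! hcon
      obtain ⟨h0, h1, -⟩ := hcon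
      simp only [m₁, hκα] at h1
      have hα' : α = (1 - 2 * u) / 2 := by linarith
      rw [hα'] at h1
      nlinarith [sq_nonneg (u - 11 / 10)])
  filter_upwards [h] with ρ hρ
  convert hρ using 1
  simp only [mixedCoeff, gradCoeffI, ← hκ, m₁, e]
  ring

end Determinants

theorem variable_mass_normal_form_nondegenerate
    (n : ℕ) (a b : ℝ) (C : Fin n → ℝ) (hC : ∑ i, C i ^ 2 = 1) :
    ∃ ρ₀ : ℝ, 0 < ρ₀ ∧ ∀ ρ : ℝ, 0 < |ρ| → |ρ| < ρ₀ →
      IsUnit (hessianIJ (Gvar a b C) (0, fun i => ρ * C i)) ∧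
      IsUnit (bordered (hessianIJ (Gvar a b C) (0, fun i => ρ * C i))
                (gradIJ (Gvar a b C) (0, fun i => ρ * C i))) := by
  have hev := (eventually_hessian_det_ne_zero a b).and (eventually_bordered_det_ne_zero a b)
  rw [eventually_nhdsWithin_iff, Metric.eventually_nhds_iff] at hev
  obtain ⟨ρ₀, hρ₀, h⟩ := hev
  refine ⟨ρ₀, hρ₀, fun ρ hpos hlt => ?_⟩
  obtain ⟨h1, h2⟩ := h (by simpa using hlt) (abs_pos.1 hpos)
  have hd : 1 + 2 * ρ + 3 * ρ ^ 2 ≠ 0 := by nlinarith [sq_nonneg (3 * ρ + 1)]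
  rw [hessianIJ_Gvar a b ρ C hC, gradIJ_Gvar a b ρ C hC]
  exact ⟨isUnit_fromBlocks_reflection C hC _ _ _ hd h1,
    isUnit_bordered_reflection C hC _ _ _ _ _ hd h2⟩

end
end
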